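/- arXiv:1712.03448 — 2 statements merged into one kernel-verified Lean document; each statement's English description precedes it below -/
import Mathlib

section
/- (Example in Section 6.2) There exist a finite set X with |X| = 4 and a monotonic attention rule μ on X that is not a random attention filter: for no finite collection of attention filters Γ_1, …, Γ_J on X and nonnegative weights ψ_1, …, ψ_J summing to 1 does μ(T|S) = Σ_j 1(Γ_j(S) = T)·ψ_j hold for all choice problems S and all nonempty T ⊆ S. -/
open Finset
open scoped Classical

variable {α : Type*} [Fintype α] [DecidableEq α]

/-- A choice rule: for every choice problem (nonempty finite set) `S`,
`π S` is a probability distribution supported on `S`. -/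
def IsChoiceRule (π : Finset α → α → ℝ) : Prop :=
  ∀ S : Finset α, S.Nonempty →
    (∀ a ∈ S, 0 ≤ π S a) ∧ (∀ a, a ∉ S → π S a = 0) ∧ (∑ a ∈ S, π S a) = 1

/-- An attention rule: for every choice problem `S`, `μ S` is a probability
distribution over the nonempty subsets of `S`.  `μ S T` is the probability of
paying attention to the consideration set `T` when the choice problem is `S`. -/
def IsAttentionRule (μ : Finset α → Finset α → ℝ) : Prop :=
  ∀ S : Finset α, S.Nonempty →
    (∀ T : Finset α, T ⊆ S → T.Nonempty → 0 ≤ μ S T) ∧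
    (∀ T : Finset α, ¬(T ⊆ S ∧ T.Nonempty) → μ S T = 0) ∧
    (∑ T ∈ S.powerset, μ S T) = 1

/-- Assumption 1 (Monotonic attention): `μ(T|S) ≤ μ(T|S−a)` for `a ∈ S − T`. -/
def MonotonicAttention (μ : Finset α → Finset α → ℝ) : Prop :=
  ∀ S T : Finset α, S.Nonempty → T ⊆ S → T.Nonempty →
    ∀ a ∈ S, a ∉ T → μ S T ≤ μ (S.erase a) T

/-- A preference: a strict linear order (asymmetric, transitive, complete). -/
structure IsPref (r : α → α → Prop) : Prop where
  asymm : ∀ a b, r a b → ¬ r b a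
  trans : ∀ a b c, r a b → r b c → r a c
  total : ∀ a b, a ≠ b → r a b ∨ r b a

/-- `a` is the `r`-maximal element of `T`. -/
def IsBest (r : α → α → Prop) (a : α) (T : Finset α) : Prop :=
  a ∈ T ∧ ∀ b ∈ T, b ≠ a → r a b

/-- `(r, μ)` represents `π` (without the monotonicity requirement on `μ`):
`π(a|S) = Σ_{T ⊆ S} 1(a is r-best in T) μ(T|S)`. -/
noncomputable def Represents (π : Finset α → α → ℝ) (r : α → α → Prop)
    (μ : Finset α → Finset α → ℝ) : Prop :=
  IsChoiceRule π ∧ IsPref r ∧ IsAttentionRule μ ∧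
  ∀ S : Finset α, S.Nonempty → ∀ a ∈ S,
    π S a = ∑ T ∈ S.powerset, if IsBest r a T then μ S T else 0

/-- `(r, μ)` is a RAM representation of `π`: a representation with `μ` monotonic. -/
def IsRAM (π : Finset α → α → ℝ) (r : α → α → Prop)
    (μ : Finset α → Finset α → ℝ) : Prop :=
  Represents π r μ ∧ MonotonicAttention μ

/-- The revealed-preference relation `P`: `a P b` iff `a ≠ b` and there is a
choice problem `S` containing `a` and `b` with `π(a|S) > π(a|S−b)`. -/
def Prel (π : Finset α → α → ℝ) (a b : α) : Prop :=
  a ≠ b ∧ ∃ S : Finset α, a ∈ S ∧ b ∈ S ∧ π S a > π (S.erase b) a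

/-- Lower contour set of `a` with respect to the preference `r`. -/
noncomputable def lowerContour (r : α → α → Prop) (a : α) : Finset α :=
  Finset.univ.filter fun b => b = a ∨ r a b

/-- An attention rule is triangular w.r.t. `r` if it puts weight only on
(intersections of `S` with) lower contour sets. -/
def Triangular (r : α → α → Prop) (μ : Finset α → Finset α → ℝ) : Prop :=
  ∀ S T : Finset α, S.Nonempty → 0 < μ S T → ∃ a ∈ S, T = lowerContour r a ∩ S

/-- A (deterministic) attention filter. -/
def IsAttentionFilter (Γ : Finset α → Finset α) : Prop :=
  ∀ S : Finset α, S.Nonempty →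
    Γ S ⊆ S ∧ (Γ S).Nonempty ∧
    ∀ a ∈ S, a ∉ Γ S → (S.erase a).Nonempty → Γ (S.erase a) = Γ S

/-- An attention filter is triangular w.r.t. `r` if each `Γ(S)` is the
intersection of `S` with a lower contour set of some element of `S`. -/
def TriangularFilter (r : α → α → Prop) (Γ : Finset α → Finset α) : Prop :=
  ∀ S : Finset α, S.Nonempty → ∃ a ∈ S, Γ S = lowerContour r a ∩ S

/-- Assumption 3 (φ-attentive at binaries). -/
def AttentiveAtBinaries (φ : ℝ) (μ : Finset α → Finset α → ℝ) : Prop :=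
  ∀ a b : α, a ≠ b →
    μ {a, b} {a, b} ≥ (1 - φ) / φ * max (μ {a, b} {a}) (μ {a, b} {b})

/-- A deterministic attention rule. -/
def Deterministic (μ : Finset α → Finset α → ℝ) : Prop :=
  ∀ S T : Finset α, S.Nonempty → μ S T = 0 ∨ μ S T = 1

/-- One of the two equally likely consideration sets of the counterexample. -/
def firstAttention (S : Finset (Fin 4)) : Finset (Fin 4) :=
  if S = {0, 1, 2, 3} ∨ S = {0, 1, 2} ∨ S = {0, 1, 3} then {0, 1}
  else if S = {0, 2, 3} then {0, 2}
  else if S = {1, 2, 3} ∨ S = {1, 3} ∨ S = {2, 3} then {3}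
  else S

/-- The other of the two equally likely consideration sets of the counterexample. -/
def secondAttention (S : Finset (Fin 4)) : Finset (Fin 4) :=
  if S = {0, 1, 2, 3} ∨ S = {0, 1, 2} then {0, 2}
  else if S = {0, 1, 3} then {1, 3}
  else if S = {0, 2, 3} then {2, 3}
  else S

/-- The number of the two equally likely consideration sets in `S` that equal `T`. -/
def attentionCount (S T : Finset (Fin 4)) : ℕ :=
  (if firstAttention S = T then 1 else 0) + (if secondAttention S = T then 1 else 0)

theorem attentionCount_eq_zero : ∀ S : Finset (Fin 4), S.Nonempty →
    ∀ T : Finset (Fin 4), ¬(T ⊆ S ∧ T.Nonempty) → attentionCount S T = 0 := by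
  decide +kernel

theorem sum_attentionCount : ∀ S : Finset (Fin 4), S.Nonempty →
    ∑ T ∈ S.powerset, attentionCount S T = 2 := by
  decide +kernel

theorem attentionCount_le_erase : ∀ S T : Finset (Fin 4), S.Nonempty → T ⊆ S → T.Nonempty →
    ∀ a ∈ S, a ∉ T → attentionCount S T ≤ attentionCount (S.erase a) T := by
  decide +kernel

theorem IsAttentionFilter.erase_eq {β : Type*} [DecidableEq β] {Γ : Finset β → Finset β}
    (hΓ : IsAttentionFilter Γ) {S T S' : Finset β} (hS : Γ S = T) (a : β) (ha : a ∈ S) (haT : a ∉ T)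
    (hS' : S.erase a = S') (hne : S'.Nonempty) : Γ S' = T := by
  subst hS hS'
  exact (hΓ S ⟨a, ha⟩).2.2 a ha haT hne

/-- An inequality valid for every attention filter on four alternatives, which the averages of
attention filters inherit. -/
theorem IsAttentionFilter.indicator_sum_le {Γ : Finset (Fin 4) → Finset (Fin 4)}
    (hΓ : IsAttentionFilter Γ) :
    (if Γ {1, 2, 3} = {3} then (1 : ℝ) else 0) + (if Γ {0, 1, 2, 3} = {0, 2} then 1 else 0) +
      (if Γ {0, 1, 2, 3} = {0, 1} then 1 else 0) + (if Γ {0, 2, 3} = {2, 3} then 1 else 0) +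
      (if Γ {0, 1, 3} = {1, 3} then 1 else 0) ≤ 2 := by
  have not_both : Γ {0, 1, 2, 3} = {0, 2} → Γ {0, 1, 2, 3} ≠ {0, 1} := fun h h' =>
    absurd (h.symm.trans h') (by decide)
  have disj₂ : Γ {1, 2, 3} = {3} → Γ {0, 2, 3} ≠ {2, 3} := fun h h' => by
    have e := hΓ.erase_eq (S' := {2, 3}) h 1 (by decide) (by decide) (by decide) (by decide)
    have e' := hΓ.erase_eq (S' := {2, 3}) h' 0 (by decide) (by decide) (by decide) (by decide)
    exact absurd (e.symm.trans e') (by decide)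
  have disj₁ : Γ {1, 2, 3} = {3} → Γ {0, 1, 3} ≠ {1, 3} := fun h h' => by
    have e := hΓ.erase_eq (S' := {1, 3}) h 2 (by decide) (by decide) (by decide) (by decide)
    have e' := hΓ.erase_eq (S' := {1, 3}) h' 0 (by decide) (by decide) (by decide) (by decide)
    exact absurd (e.symm.trans e') (by decide)
  have excl₂ : Γ {0, 1, 2, 3} = {0, 2} → Γ {0, 2, 3} ≠ {2, 3} := fun h h' => by
    have e := hΓ.erase_eq (S' := {0, 2, 3}) h 1 (by decide) (by decide) (by decide) (by decide)
    exact absurd (e.symm.trans h') (by decide)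
  have excl₁ : Γ {0, 1, 2, 3} = {0, 1} → Γ {0, 1, 3} ≠ {1, 3} := fun h h' => by
    have e := hΓ.erase_eq (S' := {0, 1, 3}) h 2 (by decide) (by decide) (by decide) (by decide)
    exact absurd (e.symm.trans h') (by decide)
  by_cases h : Γ {1, 2, 3} = {3}
  · simp only [if_neg (disj₁ h), if_neg (disj₂ h)]
    split_ifs with h₂ h₁
    · exact absurd h₁ (not_both h₂)
    all_goals norm_num
  by_cases h₂ : Γ {0, 1, 2, 3} = {0, 2}
  · simp only [if_neg h, if_neg (not_both h₂), if_neg (excl₂ h₂)]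
    split_ifs <;> norm_num
  by_cases h₁ : Γ {0, 1, 2, 3} = {0, 1}
  · simp only [if_neg h, if_neg h₂, if_neg (excl₁ h₁)]
    split_ifs <;> norm_num
  · simp only [if_neg h, if_neg h₂, if_neg h₁]
    split_ifs <;> norm_num

/-- Example in Section 6.2: On a four-element set there is a
monotonic attention rule that is not a random attention filter, i.e. not a
convex combination of attention filters. -/
theorem stmt16 :
    ∃ μ : Finset (Fin 4) → Finset (Fin 4) → ℝ,
      IsAttentionRule μ ∧ MonotonicAttention μ ∧
      ¬ ∃ (J : ℕ) (Γ : Fin J → Finset (Fin 4) → Finset (Fin 4)) (ψ : Fin J → ℝ),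
          (∀ j, IsAttentionFilter (Γ j)) ∧ (∀ j, 0 ≤ ψ j) ∧ (∑ j, ψ j) = 1 ∧
          ∀ S T : Finset (Fin 4), S.Nonempty → T ⊆ S → T.Nonempty →
            μ S T = ∑ j, if Γ j S = T then ψ j else 0 := by
  refine ⟨fun S T => (attentionCount S T : ℝ) / 2, fun S hS => ⟨fun T _ _ => by positivity,
    fun T hT => by simp [attentionCount_eq_zero S hS T hT], ?_⟩, fun S T hS hTS hT a ha haT => ?_,
    ?_⟩
  · rw [← Finset.sum_div, ← Nat.cast_sum, sum_attentionCount S hS]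
    norm_num
  · have := attentionCount_le_erase S T hS hTS hT a ha haT
    dsimp only
    gcongr
  · rintro ⟨J, Γ, ψ, hΓ, hψ, hsum, hμ⟩
    have half (S T : Finset (Fin 4)) (hS : S.Nonempty) (hTS : T ⊆ S) (hT : T.Nonempty)
        (hc : attentionCount S T = 1) : ∑ j, ψ j * (if Γ j S = T then 1 else 0) = 1 / 2 := by
      have := hμ S T hS hTS hT
      simp only [hc, Nat.cast_one] at this
      simp only [this, mul_ite, mul_one, mul_zero]
    have h₁ := half {1, 2, 3} {3} (by decide) (by decide) (by decide) (by decide)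
    have h₂ := half {0, 1, 2, 3} {0, 2} (by decide) (by decide) (by decide) (by decide)
    have h₃ := half {0, 1, 2, 3} {0, 1} (by decide) (by decide) (by decide) (by decide)
    have h₄ := half {0, 2, 3} {2, 3} (by decide) (by decide) (by decide) (by decide)
    have h₅ := half {0, 1, 3} {1, 3} (by decide) (by decide) (by decide) (by decide)
    have key := Finset.sum_le_sum fun j (_ : j ∈ Finset.univ) =>
      mul_le_mul_of_nonneg_left (hΓ j).indicator_sum_le (hψ j)
    simp only [mul_add, Finset.sum_add_distrib, ← Finset.sum_mul] at key
    rw [h₁, h₂, h₃, h₄, h₅, hsum] at key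
    norm_num at key
end

section
/- (Independent Consideration is monotonic) Let γ : X → (0,1), and for every choice problem S define β_S = 1 − Π_{a∈S}(1−γ(a)) and the attention rule μ(T|S) = (1/β_S) · Π_{a∈T} γ(a) · Π_{a∈S−T} (1−γ(a)) for nonempty T ⊆ S (and μ(T|S) = 0 otherwise). Then μ is a well-defined attention rule and is monotonic: μ(T|S) ≤ μ(T|S−a) for every choice problem S, nonempty T ⊆ S, and a ∈ S−T. -/
open Finset
open scoped Classical

variable {α : Type*} [Fintype α] [DecidableEq α]

/-- The probability that no alternative of a nonempty set is considered is less than one. -/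
theorem prod_one_sub_lt_one {ι : Type*} [DecidableEq ι] {γ : ι → ℝ}
    (hγ : ∀ a, 0 < γ a ∧ γ a < 1) {S : Finset ι} (hS : S.Nonempty) : ∏ x ∈ S, (1 - γ x) < 1 := by
  obtain ⟨a, ha⟩ := hS
  rw [← Finset.mul_prod_erase S _ ha]
  have h₁ : ∏ x ∈ S.erase a, (1 - γ x) ≤ 1 :=
    Finset.prod_le_one (fun x _ => by linarith [(hγ x).2]) fun x _ => by linarith [(hγ x).1]
  have h₀ : 0 < ∏ x ∈ S.erase a, (1 - γ x) :=
    Finset.prod_pos fun x _ => by linarith [(hγ x).2]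
  nlinarith [hγ a]

/-- The unnormalized weights of the nonempty subsets of `S` sum to `1 - ∏ x ∈ S, (1 - γ x)`. -/
theorem sum_powerset_nonempty_prod {ι : Type*} [DecidableEq ι] (γ : ι → ℝ) (S : Finset ι) :
    ∑ T ∈ S.powerset with T.Nonempty, (∏ x ∈ T, γ x) * ∏ x ∈ S \ T, (1 - γ x) =
      1 - ∏ x ∈ S, (1 - γ x) := by
  have h := Finset.prod_add γ (fun x => 1 - γ x) S
  simp only [add_sub_cancel, Finset.prod_const_one] at h
  rw [← Finset.sum_filter_add_sum_filter_not S.powerset Finset.Nonempty] at h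
  have he : S.powerset.filter (fun T => ¬T.Nonempty) = {∅} := by
    ext T
    simp only [Finset.mem_filter, Finset.mem_powerset, Finset.not_nonempty_iff_eq_empty,
      Finset.mem_singleton, and_iff_right_iff_imp]
    rintro rfl
    exact Finset.empty_subset S
  rw [he, Finset.sum_singleton, Finset.prod_empty, one_mul, Finset.sdiff_empty] at h
  linarith

/-- Independent consideration is monotonic: For
`γ : X → (0,1)`, the attention rule
`μ(T|S) = (Π_{a∈T} γ(a)) (Π_{a∈S−T} (1−γ(a))) / β_S`, with
`β_S = 1 − Π_{a∈S}(1−γ(a))`, is a well-defined attention rule and is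
monotonic. -/
theorem stmt18 (γ : α → ℝ) (hγ : ∀ a : α, 0 < γ a ∧ γ a < 1) :
    IsAttentionRule (fun S T : Finset α =>
        if T ⊆ S ∧ T.Nonempty then
          ((∏ x ∈ T, γ x) * ∏ x ∈ S \ T, (1 - γ x)) /
            (1 - ∏ x ∈ S, (1 - γ x))
        else 0) ∧
      MonotonicAttention (fun S T : Finset α =>
        if T ⊆ S ∧ T.Nonempty then
          ((∏ x ∈ T, γ x) * ∏ x ∈ S \ T, (1 - γ x)) /
            (1 - ∏ x ∈ S, (1 - γ x))
        else 0) := by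
  have hpos (S : Finset α) : 0 < ∏ x ∈ S, (1 - γ x) :=
    Finset.prod_pos fun x _ => by linarith [(hγ x).2]
  refine ⟨fun S hS => ⟨fun T hTS hT => ?_, fun T hT => if_neg hT, ?_⟩,
    fun S T hS hTS hT a haS haT => ?_⟩
  · have hβ := prod_one_sub_lt_one hγ hS
    have hT₀ : 0 < ∏ x ∈ T, γ x := Finset.prod_pos fun x _ => (hγ x).1
    simp only [hTS, hT, and_self, if_true]
    exact div_nonneg (mul_pos hT₀ (hpos _)).le (by linarith)
  · have hβ := prod_one_sub_lt_one hγ hS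
    have h := congrArg (· / (1 - ∏ x ∈ S, (1 - γ x))) (sum_powerset_nonempty_prod γ S)
    simp only [div_self (sub_pos.2 hβ).ne', Finset.sum_div, Finset.sum_filter] at h
    refine (Finset.sum_congr rfl fun T hT => ?_).trans h
    simp only [Finset.mem_powerset.1 hT, true_and, ite_div, zero_div]
  · have hTe : T ⊆ S.erase a := Finset.subset_erase.2 ⟨hTS, haT⟩
    have hβ := prod_one_sub_lt_one hγ (hT.mono hTe)
    have hT₀ : 0 < ∏ x ∈ T, γ x := Finset.prod_pos fun x _ => (hγ x).1
    have hS' := Finset.mul_prod_erase S (fun x => 1 - γ x) haS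
    have hd := Finset.mul_prod_erase (S \ T) (fun x => 1 - γ x)
      (Finset.mem_sdiff.2 ⟨haS, haT⟩)
    simp only [hTS, hTe, hT, and_self, if_true]
    rw [← hS', ← hd, ← Finset.erase_sdiff_comm]
    have ha := hγ a
    have hp := hpos (S.erase a)
    have hq := hpos (S.erase a \ T)
    refine div_le_div₀ (mul_pos hT₀ hq).le ?_ (by linarith) ?_
    · exact mul_le_mul_of_nonneg_left (by nlinarith) hT₀.le
    · nlinarith
end
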